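/- Closed form for the expected return time of the information debt (equation (24) in Lemma 2 of the paper): assume π_G + π_B = 1, the row-sum conditions Γ₀₀^a + Γ_s^a · 1_ζ = 1 and Q^a · 1_ζ + Γ_e^a = 1_ζ (entrywise) for each a ∈ {G,B}, and that the powers (T_ζ 𝐐)^m converge to the zero matrix entrywise as m → ∞. Then the series ∑_{k=2}^∞ k · ( [π_G, π_B] · 𝚪_s · (T_ζ 𝐐)^{k−2} · T_ζ · 𝚪ₑᶜ ) converges, and (π_G·Γ₀₀^G + π_B·Γ₀₀^B) + ∑_{k=2}^∞ k · ( [π_G, π_B] · 𝚪_s · (T_ζ 𝐐)^{k−2} · T_ζ · 𝚪ₑᶜ ) = 1 + [π_G, π_B] · 𝚪_s · (I_{2ζ} − T_ζ 𝐐)^{−1} · 1_{2ζ}, where 1_{2ζ} is the all-ones 2ζ-vector. -/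

import Mathlib

open Matrix Filter

/-- The `2ζ×2ζ` block state-transition matrix `T_ζ`. -/
noncomputable def Tblock (p r : ℝ) (ζ : ℕ) :
    Matrix (Fin 2 × Fin ζ) (Fin 2 × Fin ζ) ℝ :=
  Matrix.of fun x y =>
    (!![1 - p, p; r, 1 - r] : Matrix (Fin 2) (Fin 2) ℝ) x.1 y.1 *
      (if x.2 = y.2 then 1 else 0)

/-- The `2×2ζ` block-diagonal matrix `𝚪_s` with diagonal blocks `Γ_s^G, Γ_s^B`. -/
noncomputable def GammaSblock {ζ : ℕ} (Γs : Fin 2 → Matrix (Fin 1) (Fin ζ) ℝ) :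
    Matrix (Fin 2) (Fin 2 × Fin ζ) ℝ :=
  Matrix.of fun a y => if a = y.1 then Γs a 0 y.2 else 0

/-- The `2ζ×2ζ` block-diagonal matrix `𝐐` with diagonal blocks `Q^G, Q^B`. -/
noncomputable def Qblock {ζ : ℕ} (Q : Fin 2 → Matrix (Fin ζ) (Fin ζ) ℝ) :
    Matrix (Fin 2 × Fin ζ) (Fin 2 × Fin ζ) ℝ :=
  Matrix.of fun x y => if x.1 = y.1 then Q x.1 x.2 y.2 else 0

/-- The `2ζ×1` stacked column vector `𝚪ₑᶜ = [Γ_e^G; Γ_e^B]`. -/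
noncomputable def GammaEcol {ζ : ℕ} (Γe : Fin 2 → Matrix (Fin ζ) (Fin 1) ℝ) :
    Matrix (Fin 2 × Fin ζ) (Fin 1) ℝ :=
  Matrix.of fun x _ => Γe x.1 x.2 0

/-- The all-ones `n×1` column vector. -/
noncomputable def onesCol (n : ℕ) : Matrix (Fin n) (Fin 1) ℝ := Matrix.of fun _ _ => 1

/-- The all-ones `2ζ×1` column vector `1_{2ζ}`. -/
noncomputable def onesColBlock (ζ : ℕ) : Matrix (Fin 2 × Fin ζ) (Fin 1) ℝ :=
  Matrix.of fun _ _ => 1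

/-- In a normed ring, if the powers of `x` tend to zero then they do so geometrically fast. -/
theorem exists_norm_pow_le_geometric {R : Type*} [NormedRing R] {x : R}
    (hx : Tendsto (fun n : ℕ => x ^ n) atTop (nhds 0)) :
    ∃ C ρ : ℝ, 0 ≤ ρ ∧ ρ < 1 ∧ ∀ n : ℕ, ‖x ^ n‖ ≤ C * ρ ^ n := by
  have hn : Tendsto (fun n : ℕ => ‖x ^ n‖) atTop (nhds 0) := by simpa using hx.norm
  obtain ⟨M, hM⟩ := hn.bddAbove_range
  replace hM : ∀ n : ℕ, ‖x ^ n‖ ≤ M := fun n => hM ⟨n, rfl⟩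
  obtain ⟨m, hm, hm0⟩ :=
    ((hn.eventually (ge_mem_nhds (show (0 : ℝ) < 1 / 2 by norm_num))).and
      (eventually_gt_atTop 0)).exists
  set ρ : ℝ := (1 / 2 : ℝ) ^ ((m : ℝ)⁻¹) with hρ
  have hρm : ρ ^ m = 1 / 2 := Real.rpow_inv_natCast_pow (by norm_num) hm0.ne'
  have hρ0 : 0 ≤ ρ := by positivity
  have hρ1 : ρ < 1 := by
    by_contra! h
    linarith [one_le_pow₀ h (n := m)]
  refine ⟨2 * M, ρ, hρ0, hρ1, fun n => ?_⟩
  have hM0 : 0 ≤ M := (norm_nonneg _).trans (hM 0)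
  induction n using Nat.strong_induction_on with
  | _ n ih =>
    rcases lt_or_ge n m with h | h
    · have : (1 / 2 : ℝ) ≤ ρ ^ n := hρm ▸ pow_le_pow_of_le_one hρ0 hρ1.le h.le
      nlinarith [hM n]
    · obtain ⟨k, rfl⟩ := Nat.exists_eq_add_of_le h
      calc ‖x ^ (m + k)‖ ≤ ‖x ^ m‖ * ‖x ^ k‖ := by rw [pow_add]; exact norm_mul_le _ _
        _ ≤ 1 / 2 * (2 * M * ρ ^ k) := by
          gcongr
          exact ih k (by omega)
        _ = 2 * M * ρ ^ (m + k) := by rw [pow_add, hρm]; ring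

/-- If the powers of `x` tend to zero, then `1 - x` has a left inverse `s` and
`∑ (k + 2) (x ^ k - x ^ (k + 1)) = 1 + s`. -/
theorem exists_hasSum_add_two_smul_pow_sub {R : Type*} [NormedRing R] [NormedAlgebra ℝ R]
    [CompleteSpace R] {x : R} (hx : Tendsto (fun n : ℕ => x ^ n) atTop (nhds 0)) :
    ∃ s : R, s * (1 - x) = 1 ∧
      HasSum (fun k : ℕ => ((k : ℝ) + 2) • (x ^ k * (1 - x))) (1 + s) := by
  obtain ⟨C, ρ, hρ0, hρ1, hle⟩ := exists_norm_pow_le_geometric hx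
  have hgeom : Summable fun k : ℕ => ρ ^ k := summable_geometric_of_lt_one hρ0 hρ1
  have hlin : Summable fun k : ℕ => (k : ℝ) * ρ ^ k := by
    simpa using summable_pow_mul_geometric_of_norm_lt_one 1
      (r := ρ) (by rwa [Real.norm_of_nonneg hρ0])
  obtain ⟨s, hs⟩ : Summable fun k : ℕ => x ^ k :=
    Summable.of_norm_bounded (hgeom.mul_left C) hle
  obtain ⟨g, hg⟩ : Summable fun k : ℕ => ((k : ℝ) + 1) • x ^ k := by
    refine Summable.of_norm_bounded ((hlin.add hgeom).mul_left C) fun k => ?_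
    rw [norm_smul, Real.norm_of_nonneg (by positivity)]
    nlinarith [mul_le_mul_of_nonneg_left (hle k) (show (0 : ℝ) ≤ (k : ℝ) + 1 by positivity)]
  have hs' := (hasSum_nat_add_iff' 1).mpr hs
  have hg' := (hasSum_nat_add_iff' 1).mpr hg
  have hsx : s * x = s - 1 := by
    refine (hs.mul_right x).unique ?_
    simpa [pow_succ] using hs'
  refine ⟨s, by rw [mul_sub, mul_one, hsx]; abel, ?_⟩
  have hval : g + s - (g - ∑ i ∈ Finset.range 1, ((i : ℝ) + 1) • x ^ i) = 1 + s := by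
    simp
    abel
  have hterm : (fun k : ℕ => ((k : ℝ) + 2) • (x ^ k * (1 - x))) = fun k : ℕ =>
      ((k : ℝ) + 1) • x ^ k + x ^ k - (((k + 1 : ℕ) : ℝ) + 1) • x ^ (k + 1) := by
    funext k
    rw [mul_sub, mul_one, ← pow_succ, smul_sub]
    push_cast
    module
  rw [← hval, hterm]
  exact (hg.add hs).sub hg'

section

attribute [local instance] Matrix.linftyOpNormedRing Matrix.linftyOpNormedAlgebra

/-- If the powers of a real square matrix `A` tend to zero, then
`∑ (k + 2) A ^ k (1 - A) = 1 + (1 - A)⁻¹`. -/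
theorem Matrix.hasSum_add_two_smul_pow_mul_one_sub {n : Type*} [Fintype n] [DecidableEq n]
    {A : Matrix n n ℝ} (hA : Tendsto (fun m : ℕ => A ^ m) atTop (nhds 0)) :
    HasSum (fun k : ℕ => ((k : ℝ) + 2) • (A ^ k * (1 - A))) (1 + (1 - A)⁻¹) := by
  obtain ⟨s, hs, hsum⟩ := exists_hasSum_add_two_smul_pow_sub hA
  rwa [Matrix.inv_eq_left_inv hs]

end

theorem Tblock_mul_onesColBlock (p r : ℝ) (ζ : ℕ) :
    Tblock p r ζ * onesColBlock ζ = onesColBlock ζ := by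
  ext ⟨a, i⟩ j
  fin_cases a <;> simp [Tblock, onesColBlock, Matrix.mul_apply, Fintype.sum_prod_type]

theorem Qblock_mul_onesColBlock_add_GammaEcol {ζ : ℕ} {Q : Fin 2 → Matrix (Fin ζ) (Fin ζ) ℝ}
    {Γe : Fin 2 → Matrix (Fin ζ) (Fin 1) ℝ}
    (h : ∀ a : Fin 2, Q a * onesCol ζ + Γe a = onesCol ζ) :
    Qblock Q * onesColBlock ζ + GammaEcol Γe = onesColBlock ζ := by
  ext ⟨a, i⟩ j
  have := congrFun (congrFun (h a) i) 0
  fin_cases a <;>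
    simpa [Qblock, GammaEcol, onesCol, onesColBlock, Matrix.mul_apply,
      Fintype.sum_prod_type] using this

theorem Tblock_mul_GammaEcol {ζ : ℕ} (p r : ℝ) {Q : Fin 2 → Matrix (Fin ζ) (Fin ζ) ℝ}
    {Γe : Fin 2 → Matrix (Fin ζ) (Fin 1) ℝ}
    (h : ∀ a : Fin 2, Q a * onesCol ζ + Γe a = onesCol ζ) :
    Tblock p r ζ * GammaEcol Γe = (1 - Tblock p r ζ * Qblock Q) * onesColBlock ζ := by
  rw [eq_sub_of_add_eq' (Qblock_mul_onesColBlock_add_GammaEcol h), Matrix.mul_sub,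
    Tblock_mul_onesColBlock, Matrix.sub_mul, Matrix.one_mul, Matrix.mul_assoc]

/-- **Equation (24) of Lemma 2** (closed form for the expected return time of the information
debt): under `π_G + π_B = 1`, the row-sum conditions, and `(T_ζ 𝐐)^m → 0` entrywise,
the series `∑_{k=2}^∞ k·([π_G,π_B]·𝚪_s·(T_ζ𝐐)^{k-2}·T_ζ·𝚪ₑᶜ)` converges and
`(π_G Γ₀₀^G + π_B Γ₀₀^B) + ∑_{k=2}^∞ k·(…) = 1 + [π_G,π_B]·𝚪_s·(I − T_ζ𝐐)⁻¹·1_{2ζ}`. -/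
theorem expected_return_time_closed_form (ζ : ℕ) (hζ : 1 ≤ ζ) (p r πG πB : ℝ)
    (Γ00G Γ00B : ℝ)
    (Γs : Fin 2 → Matrix (Fin 1) (Fin ζ) ℝ)
    (Q : Fin 2 → Matrix (Fin ζ) (Fin ζ) ℝ)
    (Γe : Fin 2 → Matrix (Fin ζ) (Fin 1) ℝ)
    (hπ : πG + πB = 1)
    (hrow1 : ∀ a : Fin 2, ![Γ00G, Γ00B] a + (Γs a * onesCol ζ) 0 0 = 1)
    (hrow2 : ∀ a : Fin 2, Q a * onesCol ζ + Γe a = onesCol ζ)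
    (hconv : Tendsto (fun m : ℕ => (Tblock p r ζ * Qblock Q) ^ m) atTop (nhds 0)) :
    Summable (fun k : ℕ => ((k : ℝ) + 2) *
        (((Matrix.of fun (_ : Fin 1) (a : Fin 2) => ![πG, πB] a) * GammaSblock Γs *
            (Tblock p r ζ * Qblock Q) ^ k * Tblock p r ζ * GammaEcol Γe) 0 0)) ∧
    (πG * Γ00G + πB * Γ00B) +
      (∑' k : ℕ, ((k : ℝ) + 2) *
        (((Matrix.of fun (_ : Fin 1) (a : Fin 2) => ![πG, πB] a) * GammaSblock Γs *
            (Tblock p r ζ * Qblock Q) ^ k * Tblock p r ζ * GammaEcol Γe) 0 0)) =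
    1 + ((Matrix.of fun (_ : Fin 1) (a : Fin 2) => ![πG, πB] a) * GammaSblock Γs *
          (1 - Tblock p r ζ * Qblock Q)⁻¹ * onesColBlock ζ) 0 0 := by
  set A := Tblock p r ζ * Qblock Q with hA
  set w := (Matrix.of fun (_ : Fin 1) (a : Fin 2) => ![πG, πB] a) * GammaSblock Γs with hw
  let φ : Matrix (Fin 2 × Fin ζ) (Fin 2 × Fin ζ) ℝ →+ ℝ :=
    { toFun := fun X => (w * X * onesColBlock ζ) 0 0
      map_zero' := by simp
      map_add' := fun X Y => by simp [Matrix.mul_add, Matrix.add_mul] }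
  have hφ : Continuous φ :=
    ((continuous_const.matrix_mul continuous_id).matrix_mul continuous_const).matrix_elem 0 0
  have hsum : HasSum (fun k : ℕ => ((k : ℝ) + 2) *
      ((w * A ^ k * Tblock p r ζ * GammaEcol Γe) 0 0)) (φ (1 + (1 - A)⁻¹)) := by
    convert (Matrix.hasSum_add_two_smul_pow_mul_one_sub hconv).map φ hφ using 2 with k
    rw [Matrix.mul_assoc _ (Tblock p r ζ), Tblock_mul_GammaEcol p r hrow2, ← hA]
    simp [φ, Matrix.mul_assoc]
  have hw1 : πG * Γ00G + πB * Γ00B + (w * onesColBlock ζ) 0 0 = 1 := by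
    have hG := hrow1 0
    have hB := hrow1 1
    simp only [Matrix.mul_apply, onesCol, Matrix.of_apply, mul_one, Matrix.cons_val_zero,
      Matrix.cons_val_one] at hG hB
    have hw0 : (w * onesColBlock ζ) 0 0 = πG * ∑ j, Γs 0 0 j + πB * ∑ j, Γs 1 0 j := by
      simp [hw, Matrix.mul_apply, GammaSblock, onesColBlock, Fintype.sum_prod_type,
        Finset.mul_sum]
    rw [hw0]
    linear_combination πG * hG + πB * hB + hπ
  refine ⟨hsum.summable, ?_⟩
  rw [hsum.tsum_eq, map_add, ← add_assoc]
  congr 1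
  simpa [φ] using hw1
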